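/- arXiv:math/0408158 — 2 statements merged into one kernel-verified Lean document; each statement's English description precedes it below -/
import Mathlib

section
/- Let n ≥ 1, let a, d ∈ ℝ^n with the components of a linearly independent over ℚ, let B ∈ M(n,ℤ), and let f : ℝ^n → ℝ^n be a C^∞ map such that f(x + m) − f(x) = Bm for all x ∈ ℝ^n and m ∈ ℤ^n, and such that (Df(x))a = d for all x. If the torus map induced by f is surjective, i.e. ℝ^n = ⋃_{m ∈ ℤ^n} (range(f) + m), then det B ≠ 0, i.e. B ∈ M(n,ℤ) ∩ GL(n,ℚ). -/
noncomputable section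

/-- Euclidean space `ℝ^n`. -/
abbrev Eucl (n : ℕ) := Fin n → ℝ

/-- The inclusion of the integer lattice `ℤ^n` into `ℝ^n`. -/
def intVec {n : ℕ} (m : Fin n → ℤ) : Eucl n := fun i => (m i : ℝ)

/-- The integer lattice `ℤ^n` as an additive subgroup of `ℝ^n`. -/
def intLattice (n : ℕ) : AddSubgroup (Eucl n) where
  carrier := Set.range (intVec (n := n))
  add_mem' := by
    rintro _ _ ⟨p, rfl⟩ ⟨q, rfl⟩
    exact ⟨p + q, by funext i; simp [intVec]⟩
  zero_mem' := ⟨0, by funext i; simp [intVec]⟩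
  neg_mem' := by
    rintro _ ⟨p, rfl⟩
    exact ⟨-p, by funext i; simp [intVec]⟩

/-- The `n`-torus `T^n = ℝ^n / ℤ^n`. -/
abbrev Torus (n : ℕ) := Eucl n ⧸ intLattice n

/-- The covering projection `π : ℝ^n → T^n`. -/
def torusPi (n : ℕ) : Eucl n → Torus n := QuotientAddGroup.mk

/-- `W : ℝ^n → ℝ^n` is a lift of `V : T^n → T^n`, i.e. `V ∘ π = π ∘ W`. -/
def IsLift {n : ℕ} (V : Torus n → Torus n) (W : Eucl n → Eucl n) : Prop :=
  ∀ x, V (torusPi n x) = torusPi n (W x)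

/-- An integer matrix viewed as a real matrix. -/
def matR {n : ℕ} (B : Matrix (Fin n) (Fin n) ℤ) : Matrix (Fin n) (Fin n) ℝ :=
  B.map Int.cast

/-- `W` is a `C^∞` diffeomorphism of `ℝ^n`. -/
def SmoothDiffeoR {n : ℕ} (W : Eucl n → Eucl n) : Prop :=
  ContDiff ℝ (⊤ : ℕ∞) W ∧ ∃ W' : Eucl n → Eucl n, ContDiff ℝ (⊤ : ℕ∞) W' ∧
    Function.LeftInverse W' W ∧ Function.RightInverse W' W

/-- The components of `a ∈ ℝ^n` are linearly independent over `ℚ`. -/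
def QIndep {n : ℕ} (a : Eucl n) : Prop := LinearIndependent ℚ a

/-- `R` is a generalized symmetry, with multiplier `α`, of the flow on `T^n` generated by the
constant vector field `a`: `R` is a diffeomorphism of the torus (a bijection admitting a smooth
diffeomorphism lift) and a lift `R̂` satisfies `(DR̂(x))a = αa` for all `x`. -/
def IsGenSym {n : ℕ} (a : Eucl n) (α : ℝ) (R : Torus n → Torus n) : Prop :=
  Function.Bijective R ∧ ∃ Rh : Eucl n → Eucl n, IsLift R Rh ∧ SmoothDiffeoR Rh ∧
    ∀ x, fderiv ℝ Rh x a = α • a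

/-- The multiplier group `M_a ⊆ ℝ \ {0}` of the flow generated by the constant vector field `a`. -/
def Mgroup {n : ℕ} (a : Eucl n) : Set ℝ :=
  {α | α ≠ 0 ∧ ∃ R : Torus n → Torus n, IsGenSym a α R}

/-- The flow generated by the constant vector field `a` is smoothly semiconjugate to the flow
generated by the constant vector field `b` by the surjective map `V : T^n → T^n`: `V` admits a
`C^∞` lift `W` with `(DW(x))a = b` for all `x`. -/
def SmoothSemiconj {n : ℕ} (a b : Eucl n) (V : Torus n → Torus n) : Prop :=
  Function.Surjective V ∧ ∃ W : Eucl n → Eucl n, IsLift V W ∧ ContDiff ℝ (⊤ : ℕ∞) W ∧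
    ∀ x, fderiv ℝ W x a = b

/-- The numbers `ϑ * a 1, …, ϑ * a n` all lie in the subfield `F` of `ℝ` and form a basis of `F`
as a vector space over `ℚ`. -/
def IsAlgebraicFreq {n : ℕ} (a : Eucl n) (ϑ : ℝ) (F : Subfield ℝ) : Prop :=
  (∀ i, ϑ * a i ∈ F) ∧ LinearIndependent ℚ (fun i => ϑ * a i) ∧
    ∀ y ∈ F, ∃ q : Fin n → ℚ, y = ∑ i, (q i : ℝ) * (ϑ * a i)

open MeasureTheory UnitAddTorus

local instance : MeasureSpace UnitAddCircle := ⟨AddCircle.haarAddCircle⟩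

local instance : Measure.IsAddHaarMeasure (volume : Measure UnitAddCircle) :=
  inferInstanceAs (Measure.IsAddHaarMeasure AddCircle.haarAddCircle)

local instance : IsProbabilityMeasure (volume : Measure UnitAddCircle) :=
  inferInstanceAs (IsProbabilityMeasure AddCircle.haarAddCircle)

/-- The componentwise projection `ℝ^n → (ℝ / ℤ)^n`. -/
def toUnitAddTorus (n : ℕ) : Eucl n → UnitAddTorus (Fin n) := fun x i => (x i : UnitAddCircle)

theorem isOpenQuotientMap_toUnitAddTorus (n : ℕ) : IsOpenQuotientMap (toUnitAddTorus n) :=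
  IsOpenQuotientMap.piMap fun _ => QuotientAddGroup.isOpenQuotientMap_mk

theorem toUnitAddTorus_add {n : ℕ} (x y : Eucl n) :
    toUnitAddTorus n (x + y) = toUnitAddTorus n x + toUnitAddTorus n y := by
  funext i
  simp [toUnitAddTorus]

theorem exists_eq_add_intVec_of_toUnitAddTorus_eq {n : ℕ} {x y : Eucl n}
    (h : toUnitAddTorus n x = toUnitAddTorus n y) : ∃ m : Fin n → ℤ, y = x + intVec m := by
  have key : ∀ i, ∃ k : ℤ, y i - x i = k := fun i => by
    obtain ⟨k, hk⟩ := (QuotientAddGroup.eq_iff_sub_mem.mp (congrFun h i).symm)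
    exact ⟨k, by simpa using hk.symm⟩
  choose m hm using key
  exact ⟨m, funext fun i => by simp [intVec, ← hm i]⟩

theorem mFourier_toUnitAddTorus {n : ℕ} (m : Fin n → ℤ) (x : Eucl n) :
    mFourier m (toUnitAddTorus n x) =
      Complex.exp (2 * Real.pi * Complex.I * ((∑ i, (m i : ℝ) * x i : ℝ) : ℂ)) := by
  simp only [mFourier, toUnitAddTorus, ContinuousMap.coe_mk, fourier_coe_apply]
  rw [← Complex.exp_sum]
  congr 1
  push_cast
  rw [Finset.mul_sum]
  refine Finset.sum_congr rfl fun i _ => ?_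
  ring

theorem mFourier_apply_add {n : ℕ} (m : Fin n → ℤ) (x y : UnitAddTorus (Fin n)) :
    mFourier m (x + y) = mFourier m x * mFourier m y := by
  simp only [mFourier, ContinuousMap.coe_mk, Pi.add_apply, ← Finset.prod_mul_distrib]
  refine Finset.prod_congr rfl fun i _ => ?_
  simp [fourier_apply, smul_add, AddCircle.toCircle_add]

theorem QIndep.sum_mul_ne_zero {n : ℕ} {a : Eucl n} (ha : QIndep a) {m : Fin n → ℤ}
    (hm : m ≠ 0) : ∑ i, (m i : ℝ) * a i ≠ 0 := by
  intro h
  refine hm (funext fun i => ?_)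
  have := Fintype.linearIndependent_iff.mp ha (fun i => (m i : ℚ))
    (by simpa [Rat.smul_def] using h) i
  exact_mod_cast this

/-- A continuous function on the torus invariant under an irrational linear flow is constant. -/
theorem eq_of_invariant_linear_flow {n : ℕ} {a : Eucl n} (ha : QIndep a)
    (φ : C(UnitAddTorus (Fin n), ℂ))
    (hφ : ∀ (t : ℝ) x, φ (x + toUnitAddTorus n (t • a)) = φ x) (x y : UnitAddTorus (Fin n)) :
    φ x = φ y := by
  have hcoeff : ∀ m : Fin n → ℤ, m ≠ 0 → mFourierCoeff φ m = 0 := by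
    intro m hm
    have hθ := ha.sum_mul_ne_zero (neg_ne_zero.mpr hm)
    set θ : ℝ := ∑ i, ((-m) i : ℝ) * a i with hθdef
    set v := toUnitAddTorus n ((1 / (2 * θ)) • a) with hv
    have hexp : mFourier (-m) v = -1 := by
      have hsum : ∑ i, ((-m) i : ℝ) * ((1 / (2 * θ)) • a) i = 1 / 2 := by
        simp only [Pi.smul_apply, smul_eq_mul, mul_left_comm _ (1 / (2 * θ)), ← Finset.mul_sum]
        rw [← hθdef]
        field_simp
      rw [hv, mFourier_toUnitAddTorus, hsum, ← Complex.exp_pi_mul_I]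
      congr 1
      push_cast
      ring
    have hneg : mFourierCoeff φ m = -mFourierCoeff φ m := by
      unfold mFourierCoeff
      conv_lhs => rw [← integral_add_right_eq_self _ v]
      rw [← integral_neg]
      refine integral_congr_ae (Filter.Eventually.of_forall fun z => ?_)
      have hφv : φ (z + v) = φ z := hφ _ z
      simp only [mFourier_apply_add, hexp, hφv, smul_eq_mul]
      ring
    exact CharZero.eq_neg_self_iff.mp hneg
  have hsum : Summable (mFourierCoeff φ) :=
    summable_of_ne_finset_zero (s := {0}) fun m hm => hcoeff m (by simpa using hm)
  have hconst : ∀ z, φ z = mFourierCoeff φ 0 := by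
    intro z
    refine (hasSum_mFourier_series_apply_of_summable hsum z).unique ?_
    have := hasSum_single (f := fun m => mFourierCoeff φ m • mFourier m z) (0 : Fin n → ℤ)
      fun m hm => by simp [hcoeff m hm]
    simpa [mFourier_zero] using this
  rw [hconst x, hconst y]

/-- A continuous `ℤ^n`-periodic function growing linearly along an irrational linear flow is
constant. -/
theorem eq_of_periodic_of_linear_along_flow {n : ℕ} {a : Eucl n} (ha : QIndep a) {h : Eucl n → ℝ}
    (hc : Continuous h) (hper : ∀ x m, h (x + intVec m) = h x) {c : ℝ}
    (hflow : ∀ (t : ℝ) x, h (x + t • a) = h x + t * c) (x y : Eucl n) : h x = h y := by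
  have hq := isOpenQuotientMap_toUnitAddTorus n
  have hfac : Function.FactorsThrough h (toUnitAddTorus n) := fun u v huv => by
    obtain ⟨m, rfl⟩ := exists_eq_add_intVec_of_toUnitAddTorus_eq huv
    exact (hper u m).symm
  let ψ : C(UnitAddTorus (Fin n), ℝ) :=
    Topology.IsQuotientMap.lift (f := ⟨_, hq.continuous⟩) hq.isQuotientMap ⟨h, hc⟩ hfac
  have hψ : ∀ u, ψ (toUnitAddTorus n u) = h u := fun u =>
    DFunLike.congr_fun (Topology.IsQuotientMap.lift_comp (f := ⟨_, hq.continuous⟩)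
      hq.isQuotientMap ⟨h, hc⟩ hfac) u
  have hbdd : ∀ u, |h u| ≤ ‖ψ‖ := fun u => by
    rw [← hψ u]
    exact ψ.norm_coe_le_norm _
  have hc0 : c = 0 := by
    by_contra hne
    have h1 := hflow ((2 * ‖ψ‖ + 1) / c) 0
    rw [div_mul_cancel₀ _ hne] at h1
    have h2 := abs_le.mp (hbdd 0)
    have h3 := abs_le.mp (hbdd (0 + ((2 * ‖ψ‖ + 1) / c) • a))
    linarith
  let φ : C(UnitAddTorus (Fin n), ℂ) := ⟨fun z => (ψ z : ℂ), by fun_prop⟩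
  have hφ := eq_of_invariant_linear_flow ha φ (fun t z => by
    obtain ⟨u, rfl⟩ := hq.surjective z
    rw [← toUnitAddTorus_add]
    simp [φ, hψ, hflow, hc0]) (toUnitAddTorus n x) (toUnitAddTorus n y)
  simpa [φ, hψ] using hφ

/-- A differentiable map with constant derivative `d` in the direction `a` moves by `t • d` along
`t • a`. -/
theorem apply_add_smul_of_fderiv_eq {E F : Type*} [NormedAddCommGroup E] [NormedSpace ℝ E]
    [NormedAddCommGroup F] [NormedSpace ℝ F] {f : E → F} (hf : Differentiable ℝ f) {a : E} {d : F}
    (hder : ∀ x, fderiv ℝ f x a = d) (x : E) (t : ℝ) : f (x + t • a) = f x + t • d := by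
  have hderiv : ∀ s : ℝ, HasDerivAt (fun s : ℝ => f (x + s • a) - s • d) 0 s := by
    intro s
    have h1 : HasDerivAt (fun s : ℝ => x + s • a) a s := by
      simpa using ((hasDerivAt_id s).smul_const a).const_add x
    have h2 := (hf (x + s • a)).hasFDerivAt.comp_hasDerivAt s h1
    rw [hder] at h2
    simpa using! h2.sub ((hasDerivAt_id s).smul_const d)
  have := is_const_of_deriv_eq_zero (fun s => (hderiv s).differentiableAt)
    (fun s => (hderiv s).deriv) t 0
  simp only [zero_smul, add_zero, sub_zero] at this
  rw [← this, sub_add_cancel]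

/-- if moreover the induced torus map is surjective, i.e.
`ℝ^n = ⋃_{m ∈ ℤ^n} (range f + m)`, then `det B ≠ 0`. -/
theorem stmt_4 (n : ℕ) (hn : 1 ≤ n) (a d : Eucl n) (ha : QIndep a)
    (B : Matrix (Fin n) (Fin n) ℤ) (f : Eucl n → Eucl n) (hf : ContDiff ℝ (⊤ : ℕ∞) f)
    (hcocycle : ∀ (x : Eucl n) (m : Fin n → ℤ),
      f (x + intVec m) - f x = (matR B).mulVec (intVec m))
    (hder : ∀ x : Eucl n, fderiv ℝ f x a = d)
    (hsurj : ∀ z : Eucl n, ∃ (m : Fin n → ℤ) (y : Eucl n), f y + intVec m = z) :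
    B.det ≠ 0 := by
  intro hdet
  obtain ⟨k, hk0, hkB⟩ := Matrix.exists_vecMul_eq_zero_iff.mpr hdet
  have hkB' : Matrix.vecMul (intVec k) (matR B) = 0 := by
    funext j
    have := congrFun hkB j
    simp only [Matrix.vecMul, dotProduct, Pi.zero_apply] at this
    simp only [Matrix.vecMul, dotProduct, intVec, matR, Matrix.map_apply, Pi.zero_apply]
    exact_mod_cast this
  have hconst : ∀ y, intVec k ⬝ᵥ f y = intVec k ⬝ᵥ f 0 := fun y =>
    eq_of_periodic_of_linear_along_flow ha (h := fun x => intVec k ⬝ᵥ f x)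
      (c := intVec k ⬝ᵥ d)
      (by have := hf.continuous; simp only [dotProduct]; fun_prop)
      (fun x m => by
        rw [eq_add_of_sub_eq (hcocycle x m), dotProduct_add, Matrix.dotProduct_mulVec, hkB',
          zero_dotProduct, zero_add])
      (fun t x => by
        rw [apply_add_smul_of_fderiv_eq (hf.differentiable (by simp)) hder, dotProduct_add,
          dotProduct_smul, smul_eq_mul])
      y 0
  have hkk : intVec k ⬝ᵥ intVec k ≠ 0 := by
    rw [Ne, dotProduct_self_eq_zero]
    exact fun h => hk0 (funext fun i => by simpa [intVec] using congrFun h i)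
  obtain ⟨m, y, hmy⟩ :=
    hsurj (((intVec k ⬝ᵥ f 0 + 1 / 2) / (intVec k ⬝ᵥ intVec k)) • intVec k)
  have h := congrArg (intVec k ⬝ᵥ ·) hmy
  simp only [dotProduct_add, hconst, dotProduct_smul, smul_eq_mul, div_mul_cancel₀ _ hkk] at h
  have hint : intVec k ⬝ᵥ intVec m = ((k ⬝ᵥ m : ℤ) : ℝ) := by simp [dotProduct, intVec]
  rw [hint] at h
  have h2 : 2 * (k ⬝ᵥ m) = 1 := by
    have : (2 * ((k ⬝ᵥ m : ℤ) : ℝ)) = 1 := by linarith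
    exact_mod_cast this
  omega
end
end

section
/- Let n ≥ 1, let a ∈ ℝ^n be ℚ-independent, let b ∈ ℝ^n, and suppose the flow generated by the constant vector field a is smoothly semiconjugate to the flow generated by the constant vector field b by a surjective map V : T^n → T^n, i.e. V admits a C^∞ lift W with (DW(x))a = b for all x ∈ ℝ^n. Then the components of b are linearly independent over ℚ (so the second flow is quasiperiodic), and V is a covering map. -/
noncomputable section

open MeasureTheory Matrix in
theorem mFourierCoeff_eq_zero_of_translation_invariant {n : ℕ} (f : UnitAddTorus (Fin n) → ℂ)
    (k : Fin n → ℤ) (v : Eucl n)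
    (hf : ∀ x : Eucl n, f (fun i => ((x + v) i : UnitAddCircle)) = f (fun i => (x i : UnitAddCircle)))
    (hv : UnitAddTorus.mFourier (-k) (fun i => (v i : UnitAddCircle)) ≠ 1) :
    UnitAddTorus.mFourierCoeff f k = 0 := by
  set c := UnitAddTorus.mFourier (-k) (fun i => (v i : UnitAddCircle)) with hc
  have key : UnitAddTorus.mFourierCoeff f k = c * UnitAddTorus.mFourierCoeff f k := by
    conv_lhs => rw [UnitAddTorus.mFourierCoeff_eq_integral f k v]
    rw [UnitAddTorus.mFourierCoeff_eq_integral f k 0, ← integral_const_mul,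
      ← (measurePreserving_add_right (volume : Measure (Eucl n)) v).setIntegral_preimage_emb
        (measurableEmbedding_addRight v)]
    have hset : (fun x : Eucl n => x + v) ⁻¹' {x | ∀ i, x i ∈ Set.Ioc (v i) (v i + 1)} =
        {x | ∀ i, x i ∈ Set.Ioc ((0 : Eucl n) i) ((0 : Eucl n) i + 1)} := by
      ext x
      simp only [Set.mem_preimage, Set.mem_ofPred_eq, Set.mem_Ioc, Pi.add_apply, Pi.zero_apply]
      refine forall_congr' fun i => ?_
      constructor <;> rintro ⟨h₁, h₂⟩ <;> constructor <;> linarith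
    rw [hset]
    congr 1
    ext x
    rw [hf x, smul_eq_mul, smul_eq_mul, ← mul_assoc]
    congr 1
    simp only [hc, UnitAddTorus.mFourier, ContinuousMap.coe_mk, ← Finset.prod_mul_distrib]
    refine Finset.prod_congr rfl fun i _ => ?_
    simp only [Pi.add_apply, AddCircle.coe_add, fourier_apply, smul_add, AddCircle.toCircle_add,
      Circle.coe_mul]
    ring
  have : (1 - c) * UnitAddTorus.mFourierCoeff f k = 0 := by linear_combination key
  exact (mul_eq_zero.mp this).resolve_left (sub_ne_zero.mpr hv.symm)

theorem QIndep.intVec_dotProduct_ne_zero {n : ℕ} {a : Eucl n} (ha : QIndep a) {k : Fin n → ℤ}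
    (hk : k ≠ 0) : intVec k ⬝ᵥ a ≠ 0 := by
  intro h
  refine hk (funext fun i => ?_)
  have := Fintype.linearIndependent_iff.mp ha (fun i => (k i : ℚ)) (by
    simpa [dotProduct, intVec, Rat.smul_def] using h) i
  simpa using this

theorem mFourier_coe_eq_exp {n : ℕ} (k : Fin n → ℤ) (x : Eucl n) :
    UnitAddTorus.mFourier k (fun i => (x i : UnitAddCircle)) =
      Complex.exp (2 * Real.pi * Complex.I * (intVec k ⬝ᵥ x : ℝ)) := by
  simp only [UnitAddTorus.mFourier, ContinuousMap.coe_mk, fourier_coe_apply, ← Complex.exp_sum]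
  congr 1
  simp only [dotProduct, intVec, Complex.ofReal_sum, Finset.mul_sum]
  refine Finset.sum_congr rfl fun i _ => ?_
  push_cast
  ring

/-- A continuous `ℤ^n`-periodic function which is constant along the lines in a `ℚ`-independent
direction is constant. -/
theorem QIndep.eq_of_periodic_of_invariant {n : ℕ} {a : Eucl n} (ha : QIndep a) {P : Eucl n → ℝ}
    (hP : Continuous P) (hper : ∀ x m, P (x + intVec m) = P x)
    (hinv : ∀ x (t : ℝ), P (x + t • a) = P x) (x y : Eucl n) : P x = P y := by
  have hq' : IsOpenQuotientMap
      (fun (x : Eucl n) i => (x i : UnitAddCircle) : Eucl n → UnitAddTorus (Fin n)) :=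
    .piMap fun _ => QuotientAddGroup.isOpenQuotientMap_mk
  let q : C(Eucl n, UnitAddTorus (Fin n)) := ⟨_, hq'.continuous⟩
  have hq : Topology.IsQuotientMap q := hq'.isQuotientMap
  have hfac : ∀ x y, q x = q y → P x = P y := by
    intro x y hxy
    have : ∀ i, ∃ m : ℤ, x i + m = y i := by
      intro i
      have hi : ((x i : ℝ) : UnitAddCircle) = (y i : ℝ) := congrFun hxy i
      rw [eq_comm, ← sub_eq_zero, ← AddCircle.coe_sub, AddCircle.coe_eq_zero_iff] at hi
      obtain ⟨m, hm⟩ := hi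
      exact ⟨m, by rw [zsmul_one] at hm; linarith⟩
    choose m hm using this
    rw [← hper x m]
    congr 1
    exact funext hm
  let g : C(Eucl n, ℂ) := ⟨fun x => (P x : ℂ), Complex.continuous_ofReal.comp hP⟩
  have hg : Function.FactorsThrough g q := fun x y h => congrArg Complex.ofReal (hfac x y h)
  let f : C(UnitAddTorus (Fin n), ℂ) := hq.lift g hg
  have hfq : ∀ x, f (q x) = P x := fun x => DFunLike.congr_fun (hq.lift_comp g hg) x
  have hcoeff : ∀ k, k ≠ 0 → UnitAddTorus.mFourierCoeff f k = 0 := by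
    intro k hk
    have hka := ha.intVec_dotProduct_ne_zero hk
    refine mFourierCoeff_eq_zero_of_translation_invariant f k ((1 / (2 * (intVec k ⬝ᵥ a))) • a)
      (fun x => ?_) ?_
    · exact ((hfq _).trans (congrArg _ (hinv _ _))).trans (hfq x).symm
    · rw [mFourier_coe_eq_exp]
      have : intVec (-k) ⬝ᵥ ((1 / (2 * (intVec k ⬝ᵥ a))) • a) = -(1 / 2) := by
        have : intVec (-k) = -intVec k := by ext; simp [intVec]
        rw [this, dotProduct_smul, neg_dotProduct, smul_eq_mul]
        field_simp
      rw [this]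
      have : 2 * (Real.pi : ℂ) * Complex.I * ((-(1 / 2) : ℝ) : ℂ) = -(Real.pi * Complex.I) := by
        push_cast; ring
      rw [this, Complex.exp_neg, Complex.exp_pi_mul_I]
      norm_num
  have hconst : ∀ z, f z = UnitAddTorus.mFourierCoeff f 0 := by
    intro z
    have hs := UnitAddTorus.hasSum_mFourier_series_apply_of_summable (f := f)
      (summable_of_ne_finset_zero (s := {0}) fun k hk => hcoeff k (by simpa using hk)) z
    have := hs.unique (hasSum_single 0 fun k hk => by rw [hcoeff k hk, zero_smul])
    rw [this, UnitAddTorus.mFourier_zero]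
    simp
  exact Complex.ofReal_injective (by rw [← hfq, ← hfq, hconst, hconst])

theorem torusPi_eq_iff {n : ℕ} {x y : Eucl n} :
    torusPi n x = torusPi n y ↔ ∃ m, y = x + intVec m := by
  refine (QuotientAddGroup.eq (s := intLattice n)).trans ⟨?_, ?_⟩
  · rintro ⟨m, hm⟩
    exact ⟨m, by rw [hm]; abel⟩
  · rintro ⟨m, rfl⟩
    exact ⟨m, by abel⟩

theorem intVec_injective {n : ℕ} : Function.Injective (intVec (n := n)) := fun p q h =>
  funext fun i => by simpa [intVec] using congrFun h i

theorem isOpenQuotientMap_torusPi (n : ℕ) : IsOpenQuotientMap (torusPi n) :=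
  QuotientAddGroup.isOpenQuotientMap_mk

/-- A continuous family of integer vectors indexed by a connected space is constant. -/
theorem eq_of_continuous_of_forall_intVec {n : ℕ} {X : Type*} [TopologicalSpace X]
    [PreconnectedSpace X] {g : X → Eucl n} (hg : Continuous g) (h : ∀ x, ∃ m, g x = intVec m)
    (x y : X) : g x = g y := by
  choose k hk using h
  have hcont : Continuous k := continuous_pi fun i => by
    rw [Int.isClosedEmbedding_coe_real.isEmbedding.continuous_iff]
    refine ((continuous_apply i).comp hg).congr fun x => ?_
    simp [hk x, intVec]
  rw [hk, hk, PreconnectedSpace.constant inferInstance hcont (x := x) (y := y)]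

theorem matR_mulVec_intVec {n : ℕ} (B : Matrix (Fin n) (Fin n) ℤ) (m : Fin n → ℤ) :
    (matR B).mulVec (intVec m) = intVec (B.mulVec m) := by
  ext i
  simp [matR, intVec, Matrix.mulVec, dotProduct]

theorem intVec_vecMul_matR {n : ℕ} (B : Matrix (Fin n) (Fin n) ℤ) (m : Fin n → ℤ) :
    Matrix.vecMul (intVec m) (matR B) = intVec (Matrix.vecMul m B) := by
  ext i
  simp [matR, intVec, Matrix.vecMul, dotProduct]

theorem intVec_dotProduct_intVec {n : ℕ} (p q : Fin n → ℤ) :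
    intVec p ⬝ᵥ intVec q = ((p ⬝ᵥ q : ℤ) : ℝ) := by
  simp [intVec, dotProduct]

/-- A continuous lift of a torus map is equivariant with respect to an integer matrix. -/
theorem IsLift.exists_matrix {n : ℕ} {V : Torus n → Torus n} {W : Eucl n → Eucl n}
    (hW : IsLift V W) (hc : Continuous W) :
    ∃ B : Matrix (Fin n) (Fin n) ℤ, ∀ x m, W (x + intVec m) = W x + (matR B).mulVec (intVec m) := by
  have hint : ∀ m x, ∃ k, W (x + intVec m) - W x = intVec k := by
    intro m x
    have : torusPi n (W x) = torusPi n (W (x + intVec m)) := by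
      rw [← hW, ← hW, torusPi_eq_iff.mpr ⟨m, rfl⟩]
    obtain ⟨k, hk⟩ := torusPi_eq_iff.mp this
    exact ⟨k, by rw [hk]; abel⟩
  have hconst : ∀ m x, W (x + intVec m) - W x = W (0 + intVec m) - W 0 := fun m x =>
    eq_of_continuous_of_forall_intVec (by fun_prop) (hint m) x 0
  choose k hk using fun m => hint m 0
  let β : (Fin n → ℤ) →+ (Fin n → ℤ) := AddMonoidHom.mk' k fun p q => intVec_injective (by
    have h₁ := hconst p (intVec q)
    have h₂ : (intVec (p + q) : Eucl n) = intVec q + intVec p := by ext; simp [intVec, add_comm]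
    have h₃ : (intVec (k p + k q) : Eucl n) = intVec (k p) + intVec (k q) := by
      ext; simp [intVec]
    rw [h₃, ← hk, ← hk, ← hk, ← h₁, h₂]
    simp)
  refine ⟨LinearMap.toMatrix' β.toIntLinearMap, fun x m => ?_⟩
  rw [matR_mulVec_intVec, ← Matrix.toLin'_apply, Matrix.toLin'_toMatrix']
  change _ = _ + intVec (k m)
  rw [← hk, ← hconst m x]
  abel

theorem exists_bound_of_periodic {n : ℕ} {P : Eucl n → Eucl n} (hP : Continuous P)
    (hper : ∀ x m, P (x + intVec m) = P x) : ∃ C, ∀ x, ‖P x‖ ≤ C := by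
  obtain ⟨C, hC⟩ := (isCompact_Icc (a := (0 : Eucl n)) (b := 1)).exists_bound_of_continuousOn
    hP.continuousOn
  refine ⟨C, fun x => ?_⟩
  rw [show x = (fun i => Int.fract (x i)) + intVec (fun i => ⌊x i⌋) from
    funext fun i => (Int.fract_add_floor (x i)).symm, hper]
  exact hC _ ⟨fun i => Int.fract_nonneg _, fun i => (Int.fract_lt_one _).le⟩

theorem apply_add_smul_of_fderiv_apply_eq {n : ℕ} {W : Eucl n → Eucl n} {a b : Eucl n}
    (hW : Differentiable ℝ W) (h : ∀ x, fderiv ℝ W x a = b) (x : Eucl n) (t : ℝ) :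
    W (x + t • a) = W x + t • b := by
  have hd : ∀ s : ℝ, HasDerivAt (fun s : ℝ => W (x + s • a) - s • b) 0 s := by
    intro s
    have h₁ : HasDerivAt (fun s : ℝ => x + s • a) a s := by
      simpa using ((hasDerivAt_id s).smul_const a).const_add x
    have h₂ : HasDerivAt (fun s : ℝ => s • b) b s := by
      simpa using (hasDerivAt_id s).smul_const b
    have h₃ := ((hW (x + s • a)).hasFDerivAt.comp_hasDerivAt s h₁).sub h₂
    rw [h, sub_self] at h₃
    exact h₃
  have := is_const_of_deriv_eq_zero (fun s => (hd s).differentiableAt) (fun s => (hd s).deriv) t 0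
  simp only [zero_smul, add_zero, sub_zero] at this
  rw [← this]
  abel

theorem eq_zero_of_forall_norm_smul_le {E : Type*} [NormedAddCommGroup E] [NormedSpace ℝ E]
    {v : E} {C : ℝ} (h : ∀ t : ℝ, ‖t • v‖ ≤ C) : v = 0 := by
  by_contra hv
  have hv' : 0 < ‖v‖ := norm_pos_iff.mpr hv
  have := h ((|C| + 1) / ‖v‖)
  rw [norm_smul, Real.norm_eq_abs, abs_of_nonneg (by positivity), div_mul_cancel₀ _ hv'.ne'] at this
  linarith [le_abs_self C]

/-- A lift of a semiconjugacy between constant flows, the first one quasiperiodic, is affine. -/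
theorem exists_affine_of_semiconj {n : ℕ} {a b : Eucl n} (ha : QIndep a) {V : Torus n → Torus n}
    {W : Eucl n → Eucl n} (hlift : IsLift V W) (hW : Differentiable ℝ W)
    (hab : ∀ x, fderiv ℝ W x a = b) :
    ∃ (B : Matrix (Fin n) (Fin n) ℤ) (c : Eucl n),
      b = (matR B).mulVec a ∧ ∀ x, W x = (matR B).mulVec x + c := by
  obtain ⟨B, hB⟩ := hlift.exists_matrix hW.continuous
  have hcont : Continuous fun x => W x - (matR B).mulVec x :=
    hW.continuous.sub (Continuous.matrix_mulVec continuous_const continuous_id)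
  have hper : ∀ x m, W (x + intVec m) - (matR B).mulVec (x + intVec m) =
      W x - (matR B).mulVec x := by
    intro x m
    rw [hB, Matrix.mulVec_add]
    abel
  have hline : ∀ x (t : ℝ), W (x + t • a) - (matR B).mulVec (x + t • a) =
      W x - (matR B).mulVec x + t • (b - (matR B).mulVec a) := by
    intro x t
    rw [apply_add_smul_of_fderiv_apply_eq hW hab, Matrix.mulVec_add, Matrix.mulVec_smul, smul_sub]
    abel
  obtain ⟨C, hC⟩ := exists_bound_of_periodic hcont hper
  have hb : b - (matR B).mulVec a = 0 := by
    refine eq_zero_of_forall_norm_smul_le (C := C + C) fun t => ?_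
    rw [← sub_eq_of_eq_add' (hline 0 t)]
    exact (norm_sub_le _ _).trans (add_le_add (hC _) (hC _))
  refine ⟨B, W 0, sub_eq_zero.mp hb, fun x => ?_⟩
  have : W x - (matR B).mulVec x = W 0 - (matR B).mulVec 0 := by
    ext i
    refine ha.eq_of_periodic_of_invariant (P := fun x => (W x - (matR B).mulVec x) i)
      ((continuous_apply i).comp hcont) (fun x m => congrFun (hper x m) i) (fun x t => ?_) x 0
    simp only [hline x t, hb, smul_zero, add_zero]
  rw [Matrix.mulVec_zero, sub_zero] at this
  rw [← this]
  abel

/-- If an affine map with integer linear part induces a surjection of the torus, then its linear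
part has trivial left kernel. -/
theorem eq_zero_of_vecMul_eq_zero {n : ℕ} {V : Torus n → Torus n} (hV : Function.Surjective V)
    {W : Eucl n → Eucl n} (hlift : IsLift V W) {B : Matrix (Fin n) (Fin n) ℤ} {c : Eucl n}
    (hW : ∀ x, W x = (matR B).mulVec x + c) {u : Fin n → ℤ} (hu : Matrix.vecMul u B = 0) :
    u = 0 := by
  by_contra hne
  have hpos : (intVec u ⬝ᵥ intVec u : ℝ) ≠ 0 := by
    rw [intVec_dotProduct_intVec]
    exact_mod_cast fun h => hne (dotProduct_self_eq_zero.mp h)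
  let s : ℝ := (intVec u ⬝ᵥ c + 1 / 2) / (intVec u ⬝ᵥ intVec u)
  obtain ⟨z, hz⟩ := hV (torusPi n (s • intVec u))
  obtain ⟨x, rfl⟩ := (isOpenQuotientMap_torusPi n).surjective z
  rw [hlift, torusPi_eq_iff] at hz
  obtain ⟨m, hm⟩ := hz
  have h₁ := congrArg (fun y => intVec u ⬝ᵥ y) hm
  simp only [hW, dotProduct_add, dotProduct_smul, Matrix.dotProduct_mulVec, intVec_vecMul_matR, hu,
    intVec_dotProduct_intVec u m, smul_eq_mul, s, div_mul_cancel₀ _ hpos] at h₁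
  have h₂ : (intVec (0 : Fin n → ℤ) : Eucl n) = 0 := by ext; simp [intVec]
  rw [h₂, zero_dotProduct] at h₁
  have h₃ : ((2 * (u ⬝ᵥ m) : ℤ) : ℝ) = (1 : ℤ) := by push_cast; linarith
  have h₄ := Int.cast_injective h₃
  omega

theorem isUnit_matR {n : ℕ} {B : Matrix (Fin n) (Fin n) ℤ} (hB : B.det ≠ 0) : IsUnit (matR B) := by
  rw [Matrix.isUnit_iff_isUnit_det, isUnit_iff_ne_zero]
  have : (matR B).det = (B.det : ℝ) := (Int.cast_det B).symm
  rw [this]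
  exact_mod_cast hB

/-- The torus endomorphism induced by an integer matrix. -/
def torusHom {n : ℕ} (B : Matrix (Fin n) (Fin n) ℤ) : Torus n →+ Torus n :=
  QuotientAddGroup.map _ _ (matR B).mulVecLin.toAddMonoidHom (by
    rintro _ ⟨m, rfl⟩
    exact ⟨B.mulVec m, (matR_mulVec_intVec B m).symm⟩)

theorem torusHom_torusPi {n : ℕ} (B : Matrix (Fin n) (Fin n) ℤ) (x : Eucl n) :
    torusHom B (torusPi n x) = torusPi n ((matR B).mulVec x) := rfl

theorem isDiscrete_ker_torusHom {n : ℕ} {B : Matrix (Fin n) (Fin n) ℤ} (hB : B.det ≠ 0) :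
    IsDiscrete ((torusHom B).ker : Set (Torus n)) := by
  have hcont : Continuous fun x : Eucl n => (matR B).mulVec x :=
    Continuous.matrix_mulVec continuous_const continuous_id
  let U : Set (Eucl n) := (fun x => (matR B).mulVec x) ⁻¹' Metric.ball 0 1
  have hU : IsOpen U := Metric.isOpen_ball.preimage hcont
  have key : ∀ z ∈ (torusHom B).ker, z ∈ torusPi n '' U → z = 0 := by
    rintro _ hz ⟨x, hx, rfl⟩
    rw [AddMonoidHom.mem_ker, torusHom_torusPi] at hz
    obtain ⟨m, hm⟩ := torusPi_eq_iff.mp (show torusPi n 0 = _ from hz.symm)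
    rw [zero_add] at hm
    have hx' : ‖(matR B).mulVec x‖ < 1 := by simpa [U] using hx
    have hm0 : m = 0 := by
      ext i
      have := (norm_le_pi_norm _ i).trans_lt (hm ▸ hx')
      rw [intVec, Real.norm_eq_abs, ← Int.cast_abs] at this
      exact Int.abs_lt_one_iff.mp (by exact_mod_cast this)
    have h0 : (matR B).mulVec x = (matR B).mulVec 0 := by
      rw [hm, hm0, Matrix.mulVec_zero]
      ext; simp [intVec]
    rw [Matrix.mulVec_injective_iff_isUnit.mpr (isUnit_matR hB) h0]
    rfl
  rw [isDiscrete_iff_discreteTopology]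
  refine discreteTopology_of_isOpen_singleton_zero ?_
  have h₁ : IsOpen ((↑) ⁻¹' (torusPi n '' U) : Set (torusHom B).ker) :=
    ((isOpenQuotientMap_torusPi n).isOpenMap U hU).preimage continuous_subtype_val
  have h₂ : ((↑) ⁻¹' (torusPi n '' U) : Set (torusHom B).ker) = {0} := by
    ext z
    refine ⟨fun h => Subtype.ext (key z z.2 h), ?_⟩
    rintro rfl
    exact ⟨0, by simp [U], rfl⟩
  exact h₂ ▸ h₁

theorem isCoveringMap_of_lift_affine {n : ℕ} {V : Torus n → Torus n} {W : Eucl n → Eucl n}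
    (hlift : IsLift V W) {B : Matrix (Fin n) (Fin n) ℤ} {c : Eucl n} (hB : B.det ≠ 0)
    (hW : ∀ x, W x = (matR B).mulVec x + c) : IsCoveringMap V := by
  have hV : ∀ z, V z = torusHom B z + torusPi n c := by
    intro z
    obtain ⟨x, rfl⟩ := (isOpenQuotientMap_torusPi n).surjective z
    rw [hlift, hW, torusHom_torusPi]
    rfl
  let e : Eucl n ≃L[ℝ] Eucl n := (Matrix.toLinearEquiv' _
    ((isUnit_matR hB).invertible)).toContinuousLinearEquiv
  have he : ∀ x, W x = Homeomorph.addRight c (e x) := hW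
  have hWq : Topology.IsQuotientMap W := by
    rw [show W = Homeomorph.addRight c ∘ e.toHomeomorph from funext he]
    exact (Homeomorph.isQuotientMap _).comp (Homeomorph.isQuotientMap _)
  have hπ := (isOpenQuotientMap_torusPi n).isQuotientMap
  have hcomp : V ∘ torusPi n = torusPi n ∘ W := funext hlift
  have hVq : Topology.IsQuotientMap V := by
    have hq : Topology.IsQuotientMap (V ∘ torusPi n) := hcomp ▸ hπ.comp hWq
    exact .of_comp hπ.continuous (hπ.continuous_iff.mpr hq.continuous) hq
  refine (hVq.isAddQuotientCoveringMap_of_addSubgroup (torusHom B).ker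
    (isDiscrete_ker_torusHom hB) fun {z w} => ?_).isCoveringMap
  rw [hV, hV, add_left_inj, AddMonoidHom.mem_ker, map_add, map_neg, add_neg_eq_zero, eq_comm]

/-- if the quasiperiodic flow with `ℚ`-independent frequency vector `a` is smoothly
semiconjugate by a surjective `V` to the flow with frequency vector `b`, then `b` is
`ℚ`-independent and `V` is a covering map. -/
theorem stmt_7 (n : ℕ) (hn : 1 ≤ n) (a b : Eucl n) (ha : QIndep a)
    (V : Torus n → Torus n) (hsc : SmoothSemiconj a b V) :
    QIndep b ∧ IsCoveringMap V := by
  obtain ⟨hV, W, hlift, hW, hab⟩ := hsc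
  obtain ⟨B, c, rfl, hWB⟩ :=
    exists_affine_of_semiconj ha hlift (hW.differentiable (by simp)) hab
  have hker : ∀ u, Matrix.vecMul u B = 0 → u = 0 := fun u hu =>
    eq_zero_of_vecMul_eq_zero hV hlift hWB hu
  have hdet : B.det ≠ 0 := fun h => by
    obtain ⟨u, hu, hu0⟩ := Matrix.exists_vecMul_eq_zero_iff.mpr h
    exact hu (hker u hu0)
  refine ⟨?_, isCoveringMap_of_lift_affine hlift hdet hWB⟩
  refine (LinearIndependent.iff_fractionRing ℤ ℚ).mp (Fintype.linearIndependent_iff.mpr ?_)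
  intro u hu
  refine congrFun (hker u ?_)
  by_contra hne
  refine ha.intVec_dotProduct_ne_zero hne ?_
  rw [← intVec_vecMul_matR, ← Matrix.dotProduct_mulVec]
  simpa [dotProduct, intVec] using hu
end
end
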